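/- Let G be a Garside group of finite type and x ∈ G, and set u = 1 ∨ x⁻¹Δ^{inf_s(x)} ∨ xΔ^{−sup_s(x)}. Then u ⪯ α for every positive element α ∈ G with x^α ∈ SSS(x); moreover, u = 1 if and only if x ∈ SSS(x). -/

import Mathlib

/-- A Garside structure of finite type on a group `G`: a submonoid `P` of positive
elements with `P ∩ P⁻¹ = {1}`, such that the prefix order `a ⪯ b ↔ a⁻¹ * b ∈ P` is a
lattice order (with meet `wedge` and join `vee`), together with a Garside element `Δ ∈ P`
whose set of prefixes (the simple elements) is finite and generates `G`, satisfying
`Δ⁻¹ P Δ = P`, and such that every nontrivial positive element has a finite norm. -/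
structure GarsideStructure (G : Type*) [Group G] where
  P : Set G
  one_mem : (1 : G) ∈ P
  mul_mem : ∀ {a b : G}, a ∈ P → b ∈ P → a * b ∈ P
  eq_one_of_mem_of_inv_mem : ∀ a : G, a ∈ P → a⁻¹ ∈ P → a = 1
  wedge : G → G → G
  vee : G → G → G
  wedge_le_left : ∀ a b : G, (wedge a b)⁻¹ * a ∈ P
  wedge_le_right : ∀ a b : G, (wedge a b)⁻¹ * b ∈ P
  le_wedge : ∀ a b c : G, c⁻¹ * a ∈ P → c⁻¹ * b ∈ P → c⁻¹ * wedge a b ∈ P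
  le_vee_left : ∀ a b : G, a⁻¹ * vee a b ∈ P
  le_vee_right : ∀ a b : G, b⁻¹ * vee a b ∈ P
  vee_le : ∀ a b c : G, a⁻¹ * c ∈ P → b⁻¹ * c ∈ P → (vee a b)⁻¹ * c ∈ P
  Δ : G
  Δ_mem : Δ ∈ P
  simples_finite : {s : G | s ∈ P ∧ s⁻¹ * Δ ∈ P}.Finite
  simples_generate : Subgroup.closure {s : G | s ∈ P ∧ s⁻¹ * Δ ∈ P} = (⊤ : Subgroup G)
  conj_Delta_mem : ∀ a : G, a ∈ P → Δ⁻¹ * a * Δ ∈ P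
  mem_of_conj_Delta_mem : ∀ a : G, Δ⁻¹ * a * Δ ∈ P → a ∈ P
  norm_bounded : ∀ x : G, x ∈ P → x ≠ 1 →
    ∃ n : ℕ, ∀ L : List G, (∀ a ∈ L, a ∈ P ∧ a ≠ 1) → L.prod = x → L.length ≤ n

namespace GarsideStructure

variable {G : Type*} [Group G] (gs : GarsideStructure G)

/-- The prefix order: `a ⪯ b`. -/
def pre (a b : G) : Prop := a⁻¹ * b ∈ gs.P

/-- The suffix order: `a ≽ b` (i.e. `b` is a suffix of `a`). -/
def rdvd (a b : G) : Prop := a * b⁻¹ ∈ gs.P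

/-- Greatest common divisor with respect to the suffix order `≽` : `a ∧↰ b`. -/
def rwedge (a b : G) : G := (gs.vee a⁻¹ b⁻¹)⁻¹

/-- Least common multiple with respect to the suffix order `≽` : `a ∨↰ b`. -/
def rvee (a b : G) : G := (gs.wedge a⁻¹ b⁻¹)⁻¹

/-- Simple elements: positive prefixes of `Δ`. -/
def simple (s : G) : Prop := s ∈ gs.P ∧ s⁻¹ * gs.Δ ∈ gs.P

/-- Atoms: nontrivial positive elements which cannot be decomposed in `P`. -/
def atom (a : G) : Prop := a ∈ gs.P ∧ a ≠ 1 ∧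
  ∀ b c : G, b ∈ gs.P → c ∈ gs.P → a = b * c → b = 1 ∨ c = 1

/-- `inf x` : the maximal integer `p` with `Δ^p ⪯ x`. -/
noncomputable def ginf (x : G) : ℤ := sSup {p : ℤ | gs.pre (gs.Δ ^ p) x}

/-- `sup x` : the minimal integer `p` with `x ⪯ Δ^p`. -/
noncomputable def gsup (x : G) : ℤ := sInf {p : ℤ | gs.pre x (gs.Δ ^ p)}

/-- Canonical length `ℓ(x) = sup(x) - inf(x)`. -/
noncomputable def glen (x : G) : ℤ := gs.gsup x - gs.ginf x

/-- `‖x‖` : the maximal number of factors in a decomposition of `x` as a product of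
nontrivial positive elements. -/
noncomputable def gnorm (x : G) : ℕ :=
  sSup {k : ℕ | ∃ L : List G, (∀ a ∈ L, a ∈ gs.P ∧ a ≠ 1) ∧ L.prod = x ∧ L.length = k}

/-- The summit infimum `inf_s(x)` : the maximum of `inf` over the conjugacy class of `x`. -/
noncomputable def ginfs (x : G) : ℤ :=
  sSup {p : ℤ | ∃ y : G, (∃ α : G, α⁻¹ * x * α = y) ∧ p = gs.ginf y}

/-- The summit supremum `sup_s(x)` : the minimum of `sup` over the conjugacy class of `x`. -/
noncomputable def gsups (x : G) : ℤ :=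
  sInf {p : ℤ | ∃ y : G, (∃ α : G, α⁻¹ * x * α = y) ∧ p = gs.gsup y}

/-- The preferred prefix `𝔭(x) = (xΔ^{-inf x}) ∧ (x⁻¹Δ^{sup x}) ∧ Δ`. -/
noncomputable def pp (x : G) : G :=
  gs.wedge (gs.wedge (x * gs.Δ ^ (-gs.ginf x)) (x⁻¹ * gs.Δ ^ gs.gsup x)) gs.Δ

/-- Cyclic (left) sliding `𝔰(x) = 𝔭(x)⁻¹ x 𝔭(x)`. -/
noncomputable def sl (x : G) : G := (gs.pp x)⁻¹ * x * gs.pp x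

/-- The preferred suffix `𝔭↰(x) = (Δ^{-inf x}x) ∧↰ (Δ^{sup x}x⁻¹) ∧↰ Δ`. -/
noncomputable def ps (x : G) : G :=
  gs.rwedge (gs.rwedge (gs.Δ ^ (-gs.ginf x) * x) (gs.Δ ^ gs.gsup x * x⁻¹)) gs.Δ

/-- Cyclic right sliding `𝔰↰(x) = 𝔭↰(x) x 𝔭↰(x)⁻¹`. -/
noncomputable def rsl (x : G) : G := gs.ps x * x * (gs.ps x)⁻¹

/-- The super summit set `SSS(x)` : conjugates of `x` with maximal infimum and minimal
supremum among all conjugates of `x`. -/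
def SSS (x : G) : Set G :=
  {y | (∃ α : G, α⁻¹ * x * α = y) ∧
    ∀ z : G, (∃ α : G, α⁻¹ * x * α = z) → gs.ginf z ≤ gs.ginf y ∧ gs.gsup y ≤ gs.gsup z}

/-- The set of sliding circuits `SC(x)` : conjugates `y` of `x` with `𝔰^m(y) = y` for
some `m ≥ 1`. -/
noncomputable def SC (x : G) : Set G :=
  {y | (∃ α : G, α⁻¹ * x * α = y) ∧ ∃ m : ℕ, 1 ≤ m ∧ (gs.sl)^[m] y = y}

/-- The transport `α^{(1)} = 𝔭(x)⁻¹ α 𝔭(x^α)` of `α` at `x`. -/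
noncomputable def transport (x α : G) : G := (gs.pp x)⁻¹ * α * gs.pp (α⁻¹ * x * α)

/-- Iterated transport `α^{(i)}` of `α` at `x`: `α^{(0)} = α` and `α^{(i+1)}` is the
transport of `α^{(i)}` at `𝔰^i(x)`. -/
noncomputable def transportIter (x α : G) : ℕ → G
  | 0 => α
  | i + 1 => gs.transport ((gs.sl)^[i] x) (transportIter x α i)

/-- `c` is the `⪯`-minimal element `c_s(y)` satisfying `s ⪯ c` and `y^c ∈ SC(x)`. -/
def IsMinSCConj (x y s c : G) : Prop :=
  gs.pre s c ∧ (c⁻¹ * y * c) ∈ gs.SC x ∧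
    ∀ d : G, gs.pre s d → (d⁻¹ * y * d) ∈ gs.SC x → gs.pre c d

/-- `s` is an indecomposable conjugator starting at `u`: `u^s ∈ SC(x)`, `s ≠ 1` and there
is no `t` with `1 ≺ t ≺ s` and `u^t ∈ SC(x)`. -/
def IsIndecomposableConjugator (x u s : G) : Prop :=
  (s⁻¹ * u * s) ∈ gs.SC x ∧ s ≠ 1 ∧
    ¬ ∃ t : G, (gs.pre 1 t ∧ t ≠ 1) ∧ (gs.pre t s ∧ t ≠ s) ∧ (t⁻¹ * u * t) ∈ gs.SC x

/-- `u` is the pullback of `s` at `y = 𝔰(z)` : the `⪯`-minimal positive element with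
`z^u ∈ SSS(x)` and `s ⪯ u^{(1)}` (transport at `z`). -/
def IsPullback (x z s u : G) : Prop :=
  u ∈ gs.P ∧ (u⁻¹ * z * u) ∈ gs.SSS x ∧ gs.pre s (gs.transport z u) ∧
    ∀ u' : G, u' ∈ gs.P → (u'⁻¹ * z * u') ∈ gs.SSS x → gs.pre s (gs.transport z u') →
      gs.pre u u'

/-- The pullback `s_{(1)}` of `s` at `y = 𝔰(z)`. -/
noncomputable def pullbackOne (x z s : G) : G :=
  @Classical.epsilon G ⟨1⟩ (fun u => gs.IsPullback x z s u)

/-- The `k`-fold pullback `s_{(k)}` of `s` at `y = 𝔰^k(z)` (an element at `z`):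
`s_{(0)} = s` and `s_{(k+1)}` is the pullback at `𝔰(z)` (relative to `z`) of the `k`-fold
pullback of `s` at `𝔰^k(𝔰(z)) = y`. -/
noncomputable def pullbackIter (x : G) : G → ℕ → G → G
  | _, 0, s => s
  | z, k + 1, s => gs.pullbackOne x z (pullbackIter x (gs.sl z) k s)

end GarsideStructure

namespace GarsideStructure

variable {G : Type*} [Group G] (gs : GarsideStructure G)

theorem conj_zpow_Delta_mem (n : ℤ) {a : G} (ha : a ∈ gs.P) :
    gs.Δ ^ (-n) * a * gs.Δ ^ n ∈ gs.P := by
  induction n with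
  | zero => simpa using ha
  | succ n ih =>
    have h := gs.conj_Delta_mem _ ih
    have e : gs.Δ⁻¹ * (gs.Δ ^ (-(n : ℤ)) * a * gs.Δ ^ (n : ℤ)) * gs.Δ =
        gs.Δ ^ (-((n : ℤ) + 1)) * a * gs.Δ ^ ((n : ℤ) + 1) := by group
    rwa [e] at h
  | pred n ih =>
    apply gs.mem_of_conj_Delta_mem
    have e : gs.Δ⁻¹ * (gs.Δ ^ (-(-(n : ℤ) - 1)) * a * gs.Δ ^ (-(n : ℤ) - 1)) * gs.Δ =
        gs.Δ ^ (-(-(n : ℤ))) * a * gs.Δ ^ (-(n : ℤ)) := by group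
    rwa [e]

theorem pre_trans {a b c : G} (hab : gs.pre a b) (hbc : gs.pre b c) : gs.pre a c := by
  have h := gs.mul_mem hab hbc
  rwa [show a⁻¹ * b * (b⁻¹ * c) = a⁻¹ * c by group] at h

theorem zpow_Delta_pre_mul {a b : ℤ} {x y : G} (hx : gs.pre (gs.Δ ^ a) x)
    (hy : gs.pre (gs.Δ ^ b) y) : gs.pre (gs.Δ ^ (a + b)) (x * y) := by
  have h := gs.mul_mem (gs.conj_zpow_Delta_mem b hx) hy
  have e : gs.Δ ^ (-b) * ((gs.Δ ^ a)⁻¹ * x) * gs.Δ ^ b * ((gs.Δ ^ b)⁻¹ * y) =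
      (gs.Δ ^ (a + b))⁻¹ * (x * y) := by group
  rwa [e] at h

theorem pre_zpow_Delta_iff {c : ℤ} {x : G} :
    gs.pre x (gs.Δ ^ c) ↔ gs.pre (gs.Δ ^ (-c)) x⁻¹ := by
  unfold pre
  constructor
  · intro h
    have h := gs.conj_zpow_Delta_mem (-c) h
    have e : gs.Δ ^ (-(-c)) * (x⁻¹ * gs.Δ ^ c) * gs.Δ ^ (-c) = (gs.Δ ^ (-c))⁻¹ * x⁻¹ := by group
    rwa [e] at h
  · intro h
    have h := gs.conj_zpow_Delta_mem c h
    have e : gs.Δ ^ (-c) * ((gs.Δ ^ (-c))⁻¹ * x⁻¹) * gs.Δ ^ c = x⁻¹ * gs.Δ ^ c := by group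
    rwa [e] at h

theorem mul_pre_zpow_Delta {a b : ℤ} {x y : G} (hx : gs.pre x (gs.Δ ^ a))
    (hy : gs.pre y (gs.Δ ^ b)) : gs.pre (x * y) (gs.Δ ^ (a + b)) := by
  rw [pre_zpow_Delta_iff] at *
  rw [mul_inv_rev, neg_add_rev]
  exact gs.zpow_Delta_pre_mul hy hx

theorem zpow_Delta_pre_pow {a : ℤ} {x : G} (hx : gs.pre (gs.Δ ^ a) x) (n : ℕ) :
    gs.pre (gs.Δ ^ (a * n)) (x ^ n) := by
  induction n with
  | zero => simpa [pre] using gs.one_mem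
  | succ n ih =>
    rw [pow_succ, Nat.cast_succ, mul_add, mul_one]
    exact gs.zpow_Delta_pre_mul ih hx

theorem pow_pre_zpow_Delta {a : ℤ} {x : G} (hx : gs.pre x (gs.Δ ^ a)) (n : ℕ) :
    gs.pre (x ^ n) (gs.Δ ^ (a * n)) := by
  rw [pre_zpow_Delta_iff] at *
  rw [← inv_pow, ← neg_mul]
  exact gs.zpow_Delta_pre_pow hx n

theorem exists_zpow_Delta_bounds (x : G) :
    (∃ a : ℤ, gs.pre (gs.Δ ^ a) x) ∧ ∃ b : ℤ, gs.pre x (gs.Δ ^ b) := by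
  have hx : x ∈ Subgroup.closure {s : G | s ∈ gs.P ∧ s⁻¹ * gs.Δ ∈ gs.P} := by
    rw [gs.simples_generate]; trivial
  induction hx using Subgroup.closure_induction with
  | mem s hs => exact ⟨⟨0, by simpa [pre] using hs.1⟩, ⟨1, by simpa [pre] using hs.2⟩⟩
  | one => exact ⟨⟨0, by simpa [pre] using gs.one_mem⟩, ⟨0, by simpa [pre] using gs.one_mem⟩⟩
  | mul x y _ _ hx hy =>
    obtain ⟨⟨a, ha⟩, b, hb⟩ := hx
    obtain ⟨⟨c, hc⟩, d, hd⟩ := hy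
    exact ⟨⟨_, gs.zpow_Delta_pre_mul ha hc⟩, ⟨_, gs.mul_pre_zpow_Delta hb hd⟩⟩
  | inv x _ hx =>
    obtain ⟨⟨a, ha⟩, b, hb⟩ := hx
    exact ⟨⟨-b, gs.pre_zpow_Delta_iff.1 hb⟩, ⟨-a, gs.pre_zpow_Delta_iff.2 (by simpa using ha)⟩⟩

theorem subsingleton_of_Delta_eq_one (h : gs.Δ = 1) : Subsingleton G := by
  have h1 : ∀ g : G, g = 1 := by
    intro g
    have hle : Subgroup.closure {s : G | s ∈ gs.P ∧ s⁻¹ * gs.Δ ∈ gs.P} ≤ ⊥ := by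
      rw [Subgroup.closure_le]
      rintro s ⟨hs, hs'⟩
      rw [h, mul_one] at hs'
      exact gs.eq_one_of_mem_of_inv_mem s hs hs'
    rw [gs.simples_generate] at hle
    exact Subgroup.mem_bot.1 (hle (Subgroup.mem_top g))
  exact ⟨fun a b => (h1 a).trans (h1 b).symm⟩

theorem pow_Delta_mem (n : ℕ) : gs.Δ ^ n ∈ gs.P := by
  induction n with
  | zero => simpa using gs.one_mem
  | succ n ih => rw [pow_succ]; exact gs.mul_mem ih gs.Δ_mem

section Nontrivial

variable {gs}

theorem le_of_zpow_Delta_pre (hΔ : gs.Δ ≠ 1) {a b : ℤ}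
    (h : gs.pre (gs.Δ ^ a) (gs.Δ ^ b)) : a ≤ b := by
  by_contra! hlt
  apply hΔ
  obtain ⟨n, hn⟩ := Int.eq_ofNat_of_zero_le (show 0 ≤ a - b - 1 by omega)
  obtain rfl : a = b + 1 + n := by omega
  apply gs.eq_one_of_mem_of_inv_mem _ gs.Δ_mem
  have h := gs.mul_mem h (gs.pow_Delta_mem n)
  have e : (gs.Δ ^ (b + 1 + n))⁻¹ * gs.Δ ^ b * gs.Δ ^ n = gs.Δ⁻¹ := by group
  rwa [e] at h

/-- The lower bounds of conjugates of `x` never exceed the upper bounds of `x`. -/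
theorem le_of_zpow_Delta_pre_conj (hΔ : gs.Δ ≠ 1) {p q : ℤ} {x α : G}
    (hp : gs.pre (gs.Δ ^ p) (α⁻¹ * x * α)) (hq : gs.pre x (gs.Δ ^ q)) : p ≤ q := by
  obtain ⟨b, hb⟩ := (gs.exists_zpow_Delta_bounds α).2
  obtain ⟨a, ha⟩ := (gs.exists_zpow_Delta_bounds α⁻¹).2
  have key : ∀ n : ℕ, p * n ≤ a + q * n + b := by
    intro n
    have h₁ := gs.zpow_Delta_pre_pow hp n
    have e : (α⁻¹ * x * α) ^ n = α⁻¹ * x ^ n * α := by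
      simpa using conj_pow (a := α⁻¹) (b := x) (i := n)
    rw [e] at h₁
    exact le_of_zpow_Delta_pre hΔ (gs.pre_trans h₁
      (gs.mul_pre_zpow_Delta (gs.mul_pre_zpow_Delta ha (gs.pow_pre_zpow_Delta hq n)) hb))
  by_contra! hlt
  have h := key ((a + b).natAbs + 1)
  push_cast at h
  nlinarith [le_abs_self (a + b), abs_nonneg (a + b)]

theorem isGreatest_ginf (hΔ : gs.Δ ≠ 1) (x : G) :
    IsGreatest {p : ℤ | gs.pre (gs.Δ ^ p) x} (gs.ginf x) := by
  obtain ⟨hne, b, hb⟩ := gs.exists_zpow_Delta_bounds x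
  have hbd : BddAbove {p : ℤ | gs.pre (gs.Δ ^ p) x} :=
    ⟨b, fun p hp => le_of_zpow_Delta_pre hΔ (gs.pre_trans hp hb)⟩
  exact ⟨Int.csSup_mem hne hbd, fun p hp => le_csSup hbd hp⟩

theorem isLeast_gsup (hΔ : gs.Δ ≠ 1) (x : G) :
    IsLeast {p : ℤ | gs.pre x (gs.Δ ^ p)} (gs.gsup x) := by
  obtain ⟨⟨a, ha⟩, hne⟩ := gs.exists_zpow_Delta_bounds x
  have hbd : BddBelow {p : ℤ | gs.pre x (gs.Δ ^ p)} :=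
    ⟨a, fun p hp => le_of_zpow_Delta_pre hΔ (gs.pre_trans ha hp)⟩
  exact ⟨Int.csInf_mem hne hbd, fun p hp => csInf_le hbd hp⟩

theorem ginf_conj_le_ginfs (hΔ : gs.Δ ≠ 1) (x α : G) :
    gs.ginf (α⁻¹ * x * α) ≤ gs.ginfs x := by
  refine le_csSup ⟨gs.gsup x, ?_⟩ ⟨_, ⟨α, rfl⟩, rfl⟩
  rintro _ ⟨_, ⟨β, rfl⟩, rfl⟩
  exact le_of_zpow_Delta_pre_conj hΔ (isGreatest_ginf hΔ _).1 (isLeast_gsup hΔ x).1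

theorem gsups_le_gsup_conj (hΔ : gs.Δ ≠ 1) (x α : G) :
    gs.gsups x ≤ gs.gsup (α⁻¹ * x * α) := by
  refine csInf_le ⟨gs.ginf x, ?_⟩ ⟨_, ⟨α, rfl⟩, rfl⟩
  rintro _ ⟨_, ⟨β, rfl⟩, rfl⟩
  have h := (isGreatest_ginf hΔ x).1
  refine le_of_zpow_Delta_pre_conj (α := β⁻¹) hΔ ?_ (isLeast_gsup hΔ _).1
  rwa [show β⁻¹⁻¹ * (β⁻¹ * x * β) * β⁻¹ = x by group]

end Nontrivial

variable {gs}

theorem ginfs_eq_of_mem_SSS {x y : G} (hy : y ∈ gs.SSS x) : gs.ginfs x = gs.ginf y :=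
  IsGreatest.csSup_eq ⟨⟨y, hy.1, rfl⟩, by rintro _ ⟨z, hz, rfl⟩; exact (hy.2 z hz).1⟩

theorem gsups_eq_of_mem_SSS {x y : G} (hy : y ∈ gs.SSS x) : gs.gsups x = gs.gsup y :=
  IsLeast.csInf_eq ⟨⟨y, hy.1, rfl⟩, by rintro _ ⟨z, hz, rfl⟩; exact (hy.2 z hz).2⟩

theorem inv_mul_zpow_Delta_pre {p : ℤ} {x α : G} (hα : α ∈ gs.P)
    (h : gs.pre (gs.Δ ^ p) (α⁻¹ * x * α)) : gs.pre (x⁻¹ * gs.Δ ^ p) α := by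
  have h := gs.mul_mem (gs.conj_zpow_Delta_mem p hα) h
  have e : gs.Δ ^ (-p) * α * gs.Δ ^ p * ((gs.Δ ^ p)⁻¹ * (α⁻¹ * x * α)) =
      (x⁻¹ * gs.Δ ^ p)⁻¹ * α := by group
  rwa [e] at h

theorem mul_zpow_neg_Delta_pre {p : ℤ} {x α : G} (hα : α ∈ gs.P)
    (h : gs.pre (α⁻¹ * x * α) (gs.Δ ^ p)) : gs.pre (x * gs.Δ ^ (-p)) α := by
  rw [pre_zpow_Delta_iff, show (α⁻¹ * x * α)⁻¹ = α⁻¹ * x⁻¹ * α by group] at h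
  simpa using inv_mul_zpow_Delta_pre hα h

theorem vee_vee_pre_iff {a b c d : G} :
    gs.pre (gs.vee (gs.vee a b) c) d ↔ gs.pre a d ∧ gs.pre b d ∧ gs.pre c d := by
  constructor
  · intro h
    have h' := gs.pre_trans (gs.le_vee_left _ _) h
    exact ⟨gs.pre_trans (gs.le_vee_left _ _) h', gs.pre_trans (gs.le_vee_right _ _) h',
      gs.pre_trans (gs.le_vee_right _ _) h⟩
  · rintro ⟨ha, hb, hc⟩
    exact gs.vee_le _ _ _ (gs.vee_le _ _ _ ha hb) hc

end GarsideStructure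

open GarsideStructure

variable {G : Type*} [Group G]

/-- The element `u = 1 ∨ x⁻¹Δ^{inf_s(x)} ∨ xΔ^{-sup_s(x)}` is a prefix of every positive
element conjugating `x` into `SSS(x)`, and `u = 1` if and only if `x ∈ SSS(x)`. -/
theorem sss_minimal_step (gs : GarsideStructure G) (x : G) :
    (∀ α : G, α ∈ gs.P → α⁻¹ * x * α ∈ gs.SSS x →
      gs.pre (gs.vee (gs.vee 1 (x⁻¹ * gs.Δ ^ gs.ginfs x)) (x * gs.Δ ^ (-gs.gsups x))) α) ∧
    (gs.vee (gs.vee 1 (x⁻¹ * gs.Δ ^ gs.ginfs x)) (x * gs.Δ ^ (-gs.gsups x)) = 1 ↔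
      x ∈ gs.SSS x) := by
  by_cases hΔ : gs.Δ = 1
  · have := gs.subsingleton_of_Delta_eq_one hΔ
    refine ⟨fun α hα _ => ?_, iff_of_true (Subsingleton.elim _ _) ⟨⟨1, by simp⟩, ?_⟩⟩
    · rwa [Subsingleton.elim (gs.vee _ _) 1, pre, inv_one, one_mul]
    · intro z _
      rw [Subsingleton.elim z x]
      exact ⟨le_rfl, le_rfl⟩
  have first : ∀ α : G, α ∈ gs.P → α⁻¹ * x * α ∈ gs.SSS x →
      gs.pre (gs.vee (gs.vee 1 (x⁻¹ * gs.Δ ^ gs.ginfs x)) (x * gs.Δ ^ (-gs.gsups x))) α := by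
    intro α hα hy
    rw [ginfs_eq_of_mem_SSS hy, gsups_eq_of_mem_SSS hy]
    exact vee_vee_pre_iff.2 ⟨by simpa [pre] using hα,
      inv_mul_zpow_Delta_pre hα (isGreatest_ginf hΔ _).1,
      mul_zpow_neg_Delta_pre hα (isLeast_gsup hΔ _).1⟩
  refine ⟨first, fun hu => ?_, fun hx => ?_⟩
  · have h : gs.pre (gs.vee (gs.vee 1 (x⁻¹ * gs.Δ ^ gs.ginfs x)) (x * gs.Δ ^ (-gs.gsups x))) 1 := by
      rw [hu]
      simpa [pre] using gs.one_mem
    obtain ⟨-, hinf, hsup⟩ := vee_vee_pre_iff.1 h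
    have hinf' : gs.ginfs x ≤ gs.ginf x :=
      (isGreatest_ginf hΔ x).2 (by simpa [pre] using hinf)
    have hsup' : gs.gsup x ≤ gs.gsups x :=
      (isLeast_gsup hΔ x).2 (gs.pre_zpow_Delta_iff.2 (by simpa [pre] using hsup))
    refine ⟨⟨1, by simp⟩, ?_⟩
    rintro _ ⟨α, rfl⟩
    exact ⟨(ginf_conj_le_ginfs hΔ x α).trans hinf', hsup'.trans (gsups_le_gsup_conj hΔ x α)⟩
  · have h := first 1 gs.one_mem (by simpa using hx)
    have h₁ := gs.pre_trans (gs.le_vee_left 1 (x⁻¹ * gs.Δ ^ gs.ginfs x))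
      (gs.le_vee_left _ (x * gs.Δ ^ (-gs.gsups x)))
    exact gs.eq_one_of_mem_of_inv_mem _ (by simpa [pre] using h₁) (by simpa [pre] using h)
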